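/- Let F be a field of characteristic p, α, β ∈ F, γ ∈ F×. Then [α,γ)_{p,F} ⊗ [β,γ)_{p,F} ≅ M_p(F) ⊗ [α+β, γ)_{p,F}. -/

import Mathlib

open scoped TensorProduct

/-- The defining relations of the symbol `p`-algebra
`[a,b)_{p,F} = F⟨x,y : x^p - x = a, y^p = b, yx - xy = y⟩`. -/
inductive SymbolRel (F : Type) [Field F] (p : ℕ) (a b : F) :
    FreeAlgebra F (Fin 2) → FreeAlgebra F (Fin 2) → Prop
  | x : SymbolRel F p a b (FreeAlgebra.ι F 0 ^ p - FreeAlgebra.ι F 0) (algebraMap F _ a)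
  | y : SymbolRel F p a b (FreeAlgebra.ι F 1 ^ p) (algebraMap F _ b)
  | comm : SymbolRel F p a b
      (FreeAlgebra.ι F 1 * FreeAlgebra.ι F 0 - FreeAlgebra.ι F 0 * FreeAlgebra.ι F 1)
      (FreeAlgebra.ι F 1)

/-- The symbol `p`-algebra `[a,b)_{p,F}`. -/
abbrev SymbolAlg (F : Type) [Field F] (p : ℕ) (a b : F) : Type :=
  RingQuot (SymbolRel F p a b)

namespace SymbolAlg

variable {F : Type} [Field F] {p : ℕ} {a b : F}

/-- The generator `x` of the symbol algebra. -/
def x (p : ℕ) (a b : F) : SymbolAlg F p a b :=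
  RingQuot.mkAlgHom F (SymbolRel F p a b) (FreeAlgebra.ι F 0)

/-- The generator `y` of the symbol algebra. -/
def y (p : ℕ) (a b : F) : SymbolAlg F p a b :=
  RingQuot.mkAlgHom F (SymbolRel F p a b) (FreeAlgebra.ι F 1)

theorem x_pow : x p a b ^ p = x p a b + algebraMap F _ a := by
  have h := RingQuot.mkAlgHom_rel F (SymbolRel.x (F := F) (p := p) (a := a) (b := b))
  rw [map_sub, map_pow, AlgHom.commutes] at h
  exact sub_eq_iff_eq_add'.mp h

theorem y_pow : y p a b ^ p = algebraMap F _ b := by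
  have h := RingQuot.mkAlgHom_rel F (SymbolRel.y (F := F) (p := p) (a := a) (b := b))
  rwa [map_pow, AlgHom.commutes] at h

theorem y_mul_x : y p a b * x p a b = x p a b * y p a b + y p a b := by
  have h := RingQuot.mkAlgHom_rel F (SymbolRel.comm (F := F) (p := p) (a := a) (b := b))
  rw [map_sub, map_mul, map_mul] at h
  exact sub_eq_iff_eq_add'.mp h

section Lift

variable {R : Type*} [Semiring R] [Algebra F R]

theorem _root_.map_sub_eq_of_eq_add {A : Type*} [Ring A] (f : A →+* R) {r s : A} {c : R}
    (h : f r = f s + c) : f (r - s) = c := by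
  rw [sub_eq_add_neg, map_add, h, add_comm (f s) c, add_assoc, ← map_add, add_neg_cancel,
    map_zero, add_zero]

/-- The universal property of the symbol algebra. -/
noncomputable def lift (X Y : R) (hX : X ^ p = X + algebraMap F R a)
    (hY : Y ^ p = algebraMap F R b) (hXY : Y * X = X * Y + Y) : SymbolAlg F p a b →ₐ[F] R :=
  RingQuot.liftAlgHom F ⟨FreeAlgebra.lift F ![X, Y], by
    rintro _ _ (_ | _ | _)
    · refine map_sub_eq_of_eq_add (FreeAlgebra.lift F ![X, Y]).toRingHom ?_
      simp [hX]
    · simp [hY]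
    · refine map_sub_eq_of_eq_add (FreeAlgebra.lift F ![X, Y]).toRingHom ?_
      simp [hXY]⟩

variable {X Y : R} {hX : X ^ p = X + algebraMap F R a}
  {hY : Y ^ p = algebraMap F R b} {hXY : Y * X = X * Y + Y}

@[simp]
theorem lift_x : lift X Y hX hY hXY (x p a b) = X := by
  simp [lift, x]

@[simp]
theorem lift_y : lift X Y hX hY hXY (y p a b) = Y := by
  simp [lift, y]

theorem algHom_ext {f g : SymbolAlg F p a b →ₐ[F] R} (hx : f (x p a b) = g (x p a b))
    (hy : f (y p a b) = g (y p a b)) : f = g := by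
  apply RingQuot.ringQuot_ext'
  apply FreeAlgebra.hom_ext
  funext i
  fin_cases i
  · exact hx
  · exact hy

theorem mem_of_x_mem_of_y_mem {S : Subalgebra F (SymbolAlg F p a b)} (hx : x p a b ∈ S)
    (hy : y p a b ∈ S) (c : SymbolAlg F p a b) : c ∈ S := by
  let f : SymbolAlg F p a b →ₐ[F] S := lift ⟨_, hx⟩ ⟨_, hy⟩
    (Subtype.ext x_pow) (Subtype.ext y_pow) (Subtype.ext y_mul_x)
  have h : S.val.comp f = AlgHom.id F _ := algHom_ext (by simp [f]) (by simp [f])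
  rw [← AlgHom.id_apply (R := F) c, ← h]
  exact (f c).2

theorem commute_apply {f : SymbolAlg F p a b →ₐ[F] R} {r : R} (hx : Commute (f (x p a b)) r)
    (hy : Commute (f (y p a b)) r) (c : SymbolAlg F p a b) : Commute (f c) r := by
  have h := mem_of_x_mem_of_y_mem (S := (Subalgebra.centralizer F {r}).comap f)
    (by simpa [Subalgebra.mem_centralizer_iff] using hx.eq.symm)
    (by simpa [Subalgebra.mem_centralizer_iff] using hy.eq.symm) c
  simp only [Subalgebra.mem_comap, Subalgebra.mem_centralizer_iff, Set.mem_singleton_iff,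
    forall_eq] at h
  exact h.symm

theorem commute_apply_apply {a' b' : F} {f : SymbolAlg F p a b →ₐ[F] R}
    {g : SymbolAlg F p a' b' →ₐ[F] R}
    (hxx : Commute (f (x p a b)) (g (x p a' b'))) (hxy : Commute (f (x p a b)) (g (y p a' b')))
    (hyx : Commute (f (y p a b)) (g (x p a' b'))) (hyy : Commute (f (y p a b)) (g (y p a' b')))
    (c : SymbolAlg F p a b) (d : SymbolAlg F p a' b') : Commute (f c) (g d) :=
  commute_apply (commute_apply hxx.symm hxy.symm d).symm
    (commute_apply hyx.symm hyy.symm d).symm c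

theorem _root_.Commute.add_pow_prime_of_algebra (hp : p.Prime) [CharP F p] {r s : R}
    (h : Commute r s) : (r + s) ^ p = r ^ p + s ^ p := by
  obtain ⟨t, ht⟩ := h.exists_add_pow_prime_eq hp
  have h0 : (p : R) = 0 := by
    rw [← map_natCast (algebraMap F R), CharP.cast_eq_zero, map_zero]
  rw [ht, h0]
  simp

end Lift

section Inverse

/-- The inverse of `y`, when `b ≠ 0`. -/
noncomputable def yInv (p : ℕ) (a b : F) : SymbolAlg F p a b := b⁻¹ • y p a b ^ (p - 1)

theorem y_mul_yInv (hp : p ≠ 0) (hb : b ≠ 0) : y p a b * yInv p a b = 1 := by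
  rw [yInv, mul_smul_comm, mul_pow_sub_one hp, y_pow, Algebra.algebraMap_eq_smul_one,
    smul_smul, inv_mul_cancel₀ hb, one_smul]

theorem commute_y_yInv : Commute (y p a b) (yInv p a b) :=
  ((Commute.refl _).pow_right _).smul_right _

theorem yInv_mul_y (hp : p ≠ 0) (hb : b ≠ 0) : yInv p a b * y p a b = 1 := by
  rw [← commute_y_yInv.eq, y_mul_yInv hp hb]

theorem yInv_pow (hp : p ≠ 0) (hb : b ≠ 0) : yInv p a b ^ p = algebraMap F _ b⁻¹ := by
  have h : y p a b ^ p * yInv p a b ^ p = 1 := by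
    rw [← commute_y_yInv.mul_pow, y_mul_yInv hp hb, one_pow]
  rw [y_pow] at h
  calc yInv p a b ^ p = algebraMap F _ b⁻¹ * (algebraMap F _ b * yInv p a b ^ p) := by
        rw [← mul_assoc, ← map_mul, inv_mul_cancel₀ hb, map_one, one_mul]
    _ = _ := by rw [h, mul_one]

theorem x_mul_yInv (hp : p ≠ 0) (hb : b ≠ 0) :
    x p a b * yInv p a b = yInv p a b * x p a b + yInv p a b := by
  calc x p a b * yInv p a b = yInv p a b * (y p a b * x p a b) * yInv p a b := by
        rw [← mul_assoc, yInv_mul_y hp hb, one_mul]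
    _ = yInv p a b * x p a b * (y p a b * yInv p a b)
          + yInv p a b * (y p a b * yInv p a b) := by
        rw [y_mul_x]; noncomm_ring
    _ = _ := by rw [y_mul_yInv hp hb, mul_one, mul_one]

end Inverse

section Tensor

open Algebra.TensorProduct (tmul_pow tmul_mul_tmul one_def)

variable (α β : F) {γ : F}

/-- The homomorphism `[α + β, γ) → [α, γ) ⊗ [β, γ)` with `x ↦ x ⊗ 1 + 1 ⊗ x`, `y ↦ y ⊗ 1`. -/
noncomputable def addHom (hp : p.Prime) [CharP F p] (α β γ : F) :
    SymbolAlg F p (α + β) γ →ₐ[F] SymbolAlg F p α γ ⊗[F] SymbolAlg F p β γ :=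
  lift (x p α γ ⊗ₜ 1 + 1 ⊗ₜ x p β γ) (y p α γ ⊗ₜ 1)
    (by
      rw [Commute.add_pow_prime_of_algebra (F := F) hp (by simp [Commute, SemiconjBy]), tmul_pow,
        tmul_pow, x_pow, x_pow, one_pow, one_pow, TensorProduct.add_tmul, TensorProduct.tmul_add,
        ← Algebra.TensorProduct.algebraMap_apply, ← Algebra.TensorProduct.algebraMap_apply', map_add]
      abel)
    (by rw [tmul_pow, one_pow, y_pow, ← Algebra.TensorProduct.algebraMap_apply])
    (by
      simp only [mul_add, add_mul, tmul_mul_tmul, y_mul_x, one_mul, mul_one,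
        TensorProduct.add_tmul]
      abel)

/-- The homomorphism `[β, 1) → [α, γ) ⊗ [β, γ)` with `x ↦ 1 ⊗ x`, `y ↦ y⁻¹ ⊗ y`. -/
noncomputable def quotHom (hp : p ≠ 0) (hγ : γ ≠ 0) :
    SymbolAlg F p β 1 →ₐ[F] SymbolAlg F p α γ ⊗[F] SymbolAlg F p β γ :=
  lift (1 ⊗ₜ x p β γ) (yInv p α γ ⊗ₜ y p β γ)
    (by rw [tmul_pow, one_pow, x_pow, TensorProduct.tmul_add, ← Algebra.TensorProduct.algebraMap_apply'])
    (by
      rw [tmul_pow, yInv_pow hp hγ, y_pow, Algebra.algebraMap_eq_smul_one,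
        Algebra.algebraMap_eq_smul_one, TensorProduct.smul_tmul_smul, inv_mul_cancel₀ hγ,
        one_smul, map_one, one_def])
    (by simp only [tmul_mul_tmul, y_mul_x, one_mul, mul_one, TensorProduct.tmul_add])

/-- The homomorphism `[α, γ) → [α + β, γ) ⊗ [β, 1)` with `x ↦ x ⊗ 1 - 1 ⊗ x`, `y ↦ y ⊗ 1`. -/
noncomputable def subHom (hp : p.Prime) [CharP F p] (α β γ : F) :
    SymbolAlg F p α γ →ₐ[F] SymbolAlg F p (α + β) γ ⊗[F] SymbolAlg F p β 1 :=
  lift (x p (α + β) γ ⊗ₜ 1 + (-1 : F) • (1 ⊗ₜ x p β 1)) (y p (α + β) γ ⊗ₜ 1)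
    (by
      have := Fact.mk hp
      rw [Commute.add_pow_prime_of_algebra (F := F) hp
        (by simp only [Commute, SemiconjBy, mul_smul_comm, smul_mul_assoc, tmul_mul_tmul, one_mul,
          mul_one]), smul_pow, neg_one_pow_char F p, tmul_pow, tmul_pow, x_pow, x_pow, one_pow, one_pow,
        TensorProduct.add_tmul, TensorProduct.tmul_add,
        ← Algebra.TensorProduct.algebraMap_apply, ← Algebra.TensorProduct.algebraMap_apply']
      simp only [Algebra.algebraMap_eq_smul_one]
      module)
    (by rw [tmul_pow, one_pow, y_pow, ← Algebra.TensorProduct.algebraMap_apply])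
    (by
      simp only [mul_add, add_mul, tmul_mul_tmul, y_mul_x, one_mul, mul_one,
        TensorProduct.add_tmul, mul_smul_comm, smul_mul_assoc]
      abel)

/-- The homomorphism `[β, γ) → [α + β, γ) ⊗ [β, 1)` with `x ↦ 1 ⊗ x`, `y ↦ y ⊗ y`. -/
noncomputable def diagHom (p : ℕ) (α β γ : F) :
    SymbolAlg F p β γ →ₐ[F] SymbolAlg F p (α + β) γ ⊗[F] SymbolAlg F p β 1 :=
  lift (1 ⊗ₜ x p β 1) (y p (α + β) γ ⊗ₜ y p β 1)
    (by rw [tmul_pow, one_pow, x_pow, TensorProduct.tmul_add, ← Algebra.TensorProduct.algebraMap_apply'])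
    (by rw [tmul_pow, y_pow, y_pow, map_one, ← Algebra.TensorProduct.algebraMap_apply])
    (by simp only [tmul_mul_tmul, y_mul_x, one_mul, mul_one, TensorProduct.tmul_add])

/-- `[α, γ) ⊗ [β, γ) ≅ [α + β, γ) ⊗ [β, 1)`. -/
noncomputable def tensorEquiv (hp : p.Prime) [CharP F p] (hγ : γ ≠ 0) :
    (SymbolAlg F p α γ ⊗[F] SymbolAlg F p β γ) ≃ₐ[F]
      (SymbolAlg F p (α + β) γ ⊗[F] SymbolAlg F p β 1) :=
  AlgEquiv.ofAlgHom
    (Algebra.TensorProduct.lift (subHom hp α β γ) (diagHom p α β γ)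
      (commute_apply_apply (f := subHom hp α β γ) (g := diagHom p α β γ)
        (by simp only [subHom, diagHom, lift_x, Commute, SemiconjBy, mul_add, add_mul,
            tmul_mul_tmul, one_mul, mul_one, mul_smul_comm, smul_mul_assoc])
        (by
          simp only [subHom, diagHom, lift_x, lift_y, Commute, SemiconjBy, mul_add, add_mul,
            tmul_mul_tmul, one_mul, mul_one, y_mul_x, TensorProduct.add_tmul,
            TensorProduct.tmul_add, mul_smul_comm, smul_mul_assoc]
          module)
        (by simp [subHom, diagHom, Commute, SemiconjBy])
        (by simp [subHom, diagHom, Commute, SemiconjBy])))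
    (Algebra.TensorProduct.lift (addHom hp α β γ) (quotHom α β hp.ne_zero hγ)
      (commute_apply_apply (f := addHom hp α β γ) (g := quotHom α β hp.ne_zero hγ)
        (by simp [addHom, quotHom, Commute, SemiconjBy, mul_add, add_mul])
        (by
          simp only [addHom, quotHom, lift_x, lift_y, Commute, SemiconjBy, mul_add, add_mul,
            tmul_mul_tmul, one_mul, mul_one, y_mul_x, x_mul_yInv hp.ne_zero hγ,
            TensorProduct.add_tmul, TensorProduct.tmul_add]
          abel)
        (by simp [addHom, quotHom, Commute, SemiconjBy])
        (by simp [addHom, quotHom, Commute, SemiconjBy, commute_y_yInv.eq])))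
    (by
      apply Algebra.TensorProduct.ext <;> apply algHom_ext
      · simp only [addHom, subHom, diagHom, AlgHom.coe_comp, Function.comp_apply, map_add,
          Algebra.TensorProduct.includeLeft_apply, Algebra.TensorProduct.lift_tmul, lift_x,
          map_one, one_mul, mul_one, AlgHom.coe_id, id_eq]
        module
      · simp [addHom, subHom, diagHom]
      · simp [quotHom, subHom, diagHom]
      · have h : subHom hp α β γ (yInv p α γ) = yInv p (α + β) γ ⊗ₜ 1 := by
          simp [yInv, subHom, TensorProduct.smul_tmul']
        simp [quotHom, h, diagHom, yInv_mul_y hp.ne_zero hγ])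
    (by
      apply Algebra.TensorProduct.ext <;> apply algHom_ext
      · simp only [addHom, quotHom, subHom, AlgHom.coe_comp, Function.comp_apply, map_add, map_smul,
          Algebra.TensorProduct.includeLeft_apply, Algebra.TensorProduct.lift_tmul, lift_x,
          map_one, one_mul, mul_one, AlgHom.coe_id, id_eq]
        module
      · simp [addHom, quotHom, subHom]
      · simp [addHom, quotHom, diagHom]
      · simp [addHom, quotHom, diagHom, y_mul_yInv hp.ne_zero hγ])

end Tensor

section Split

open Polynomial

/-- The Artin–Schreier algebra `F[t]/(t ^ p - t - β)`. -/
abbrev ArtinSchreier (p : ℕ) (β : F) : Type := AdjoinRoot (X ^ p - X - C β : F[X])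

namespace ArtinSchreier

variable (p) (β : F)

/-- The class of the variable in the Artin–Schreier algebra. -/
noncomputable abbrev t : ArtinSchreier p β := AdjoinRoot.root _

theorem t_pow : t p β ^ p = t p β + algebraMap F _ β := by
  have h := AdjoinRoot.eval₂_root (X ^ p - X - C β : F[X])
  simp only [eval₂_sub, eval₂_pow, eval₂_X, eval₂_C] at h
  exact eq_add_of_sub_eq' (sub_eq_zero.mp h)

variable {p}

theorem monic (hp : p.Prime) : (X ^ p - X - C β : F[X]).Monic := by
  rw [sub_sub]
  refine monic_X_pow_sub ?_
  rw [degree_X_add_C]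
  exact_mod_cast hp.one_lt

theorem natDegree_eq (hp : p.Prime) : (X ^ p - X - C β : F[X]).natDegree = p := by
  rw [sub_sub, natDegree_sub_eq_left_of_natDegree_lt, natDegree_X_pow]
  rw [natDegree_X_add_C, natDegree_X_pow]
  exact hp.one_lt

/-- The basis of powers of `t`. -/
noncomputable def powerBasis (hp : p.Prime) : Module.Basis (Fin p) F (ArtinSchreier p β) :=
  (AdjoinRoot.powerBasis' (monic β hp)).basis.reindex (finCongr (natDegree_eq β hp))

/-- Homomorphisms out of the Artin–Schreier algebra, into a not necessarily commutative algebra. -/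
noncomputable def eval {R : Type*} [Ring R] [Algebra F R] (r : R)
    (hr : r ^ p = r + algebraMap F R β) : ArtinSchreier p β →ₐ[F] R :=
  Ideal.Quotient.liftₐ _ (aeval r) (by
    have h : Ideal.span {(X ^ p - X - C β : F[X])} ≤ RingHom.ker (aeval (R := F) r) := by
      rw [Ideal.span_singleton_le_iff_mem, RingHom.mem_ker]
      simp [hr]
    exact fun q hq => h hq)

@[simp]
theorem eval_t {R : Type*} [Ring R] [Algebra F R] (r : R)
    (hr : r ^ p = r + algebraMap F R β) : eval β r hr (t p β) = r :=
  (Ideal.Quotient.liftₐ_apply _ _ _ _).trans (aeval_X r)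

/-- The automorphism `t ↦ t + 1`. -/
noncomputable def shift (hp : p.Prime) [CharP F p] : ArtinSchreier p β →ₐ[F] ArtinSchreier p β :=
  eval β (t p β + 1) (by
    rw [Commute.add_pow_prime_of_algebra (F := F) hp (Commute.one_right _), t_pow, one_pow]
    abel)

@[simp]
theorem shift_t (hp : p.Prime) [CharP F p] : shift β hp (t p β) = t p β + 1 := eval_t _ _ _

theorem shift_pow_t (hp : p.Prime) [CharP F p] (n : ℕ) :
    (shift β hp ^ n) (t p β) = t p β + n := by
  induction n with
  | zero => simp
  | succ n ih => rw [pow_succ', AlgHom.mul_apply, ih]; simp; ring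

theorem shift_pow_prime (hp : p.Prime) [CharP F p] : shift β hp ^ p = 1 := by
  apply AdjoinRoot.algHom_ext
  rw [shift_pow_t, ← map_natCast (algebraMap F (ArtinSchreier p β)), CharP.cast_eq_zero]
  simp

/-- The twisted group algebra of the shift, as an algebra of operators. -/
noncomputable def twist (hp : p.Prime) [CharP F p] :
    (Fin p → ArtinSchreier p β) →ₗ[F] Module.End F (ArtinSchreier p β) where
  toFun v := ∑ i, LinearMap.mulLeft F (v i) * (shift β hp).toLinearMap ^ (i : ℕ)
  map_add' v w := by
    rw [← Finset.sum_add_distrib]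
    refine Finset.sum_congr rfl fun i _ => ?_
    ext; simp [add_mul]
  map_smul' c v := by
    rw [RingHom.id_apply, Finset.smul_sum]
    refine Finset.sum_congr rfl fun i _ => ?_
    ext; simp

theorem shift_toLinearMap_pow (hp : p.Prime) [CharP F p] (n : ℕ) :
    (shift β hp).toLinearMap ^ n = (shift β hp ^ n).toLinearMap := by
  induction n with
  | zero => rfl
  | succ n ih => rw [pow_succ, ih, pow_succ]; rfl

theorem twist_injective (hp : p.Prime) [CharP F p] : Function.Injective (twist β hp) := by
  rw [← LinearMap.ker_eq_bot, LinearMap.ker_eq_bot']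
  intro v hv
  have hdet : IsUnit (Matrix.vandermonde fun i : Fin p => t p β + (i : ℕ)).det := by
    rw [Matrix.det_vandermonde]
    simp only [IsUnit.prod_iff]
    intro i _ j hj
    have hij : (i : ℕ) < j := by simpa using hj
    have h : (((j - i : ℕ) : F)) ≠ 0 := by
      rw [Ne, CharP.cast_eq_zero_iff F p]
      exact Nat.not_dvd_of_pos_of_lt (by omega) (by omega)
    have hu := h.isUnit.map (algebraMap F (ArtinSchreier p β))
    rw [map_natCast, Nat.cast_sub hij.le] at hu
    rwa [add_sub_add_left_eq_sub]
  have hvec : Matrix.vecMul v (Matrix.vandermonde fun i : Fin p => t p β + (i : ℕ)) = 0 := by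
    funext k
    have h := LinearMap.congr_fun hv (t p β ^ (k : ℕ))
    simpa [twist, shift_toLinearMap_pow, map_pow, shift_pow_t, Matrix.vecMul, dotProduct,
      Matrix.vandermonde_apply] using h
  exact Matrix.vecMul_injective_of_isUnit ((Matrix.isUnit_iff_isUnit_det _).mpr hdet)
    (hvec.trans (Matrix.zero_vecMul _).symm)

theorem twist_surjective (hp : p.Prime) [CharP F p] : Function.Surjective (twist β hp) := by
  have := Module.Finite.of_basis (powerBasis β hp)
  refine (LinearMap.injective_iff_surjective_of_finrank_eq_finrank ?_).mp (twist_injective β hp)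
  rw [Module.finrank_pi_fintype, Module.finrank_linearMap,
    Module.finrank_eq_card_basis (powerBasis β hp)]
  simp

end ArtinSchreier

open ArtinSchreier

variable (β : F)

/-- The action of `[β, 1)` on the Artin–Schreier algebra. -/
noncomputable def action (hp : p.Prime) [CharP F p] :
    SymbolAlg F p β 1 →ₐ[F] Module.End F (ArtinSchreier p β) :=
  lift (LinearMap.mulLeft F (t p β)) (shift β hp).toLinearMap
    (by rw [LinearMap.pow_mulLeft, t_pow]; ext; simp [add_mul, Algebra.smul_def])
    (by rw [shift_toLinearMap_pow, shift_pow_prime, map_one]; rfl)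
    (by ext; simp [add_mul])

/-- Evaluation of Artin–Schreier elements at the generator `x`. -/
noncomputable def evalX (p : ℕ) (β b : F) : ArtinSchreier p β →ₐ[F] SymbolAlg F p β b :=
  eval β (x p β b) x_pow

theorem y_mul_evalX (hp : p.Prime) [CharP F p] {b : F} (v : ArtinSchreier p β) :
    y p β b * evalX p β b v = evalX p β b (shift β hp v) * y p β b := by
  induction v using AdjoinRoot.induction_on with
  | ih q =>
    induction q using Polynomial.induction_on' with
    | add q r hq hr => simp only [map_add, mul_add, add_mul, hq, hr]
    | monomial n c =>
      rw [← C_mul_X_pow_eq_monomial, map_mul, map_pow, AdjoinRoot.mk_X, AdjoinRoot.mk_C]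
      have hc : AdjoinRoot.of (X ^ p - X - C β : F[X]) c = algebraMap F _ c := rfl
      simp only [hc, map_mul, AlgHom.commutes, map_pow, shift_t, map_add, map_one]
      rw [← mul_assoc, ← Algebra.commutes, mul_assoc, mul_assoc]
      congr 1
      refine (SemiconjBy.pow_right ?_ n).eq
      simp [evalX, SemiconjBy, y_mul_x, add_mul]

/-- The linear map `v ↦ ∑ i, v i (x) * y ^ i`. -/
noncomputable def normalForm (p : ℕ) (β b : F) :
    (Fin p → ArtinSchreier p β) →ₗ[F] SymbolAlg F p β b where
  toFun v := ∑ i, evalX p β b (v i) * y p β b ^ (i : ℕ)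
  map_add' v w := by simp [add_mul, Finset.sum_add_distrib]
  map_smul' c v := by simp [Finset.smul_sum]

theorem evalX_mul_y_pow_mem_range (hp : p.Prime) (b : F) (v : ArtinSchreier p β) (n : ℕ) :
    evalX p β b v * y p β b ^ n ∈ LinearMap.range (normalForm p β b) := by
  have hn : y p β b ^ n = b ^ (n / p) • y p β b ^ (n % p) := by
    conv_lhs => rw [← Nat.div_add_mod n p, pow_add, pow_mul, y_pow, ← map_pow]
    rw [Algebra.smul_def]
  rw [hn, mul_smul_comm]
  refine Submodule.smul_mem _ _
    ⟨Pi.single ⟨n % p, Nat.mod_lt _ hp.pos⟩ v, ?_⟩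
  simp only [normalForm, LinearMap.coe_mk, AddHom.coe_mk]
  rw [Finset.sum_eq_single ⟨n % p, Nat.mod_lt _ hp.pos⟩]
  · simp
  · intro i _ hi
    simp [Pi.single_eq_of_ne hi]
  · simp

theorem normalForm_surjective (hp : p.Prime) [CharP F p] (b : F) :
    Function.Surjective (normalForm p β b) := by
  let S : Subalgebra F (SymbolAlg F p β b) :=
    { carrier := {c | ∀ r ∈ LinearMap.range (normalForm p β b),
        c * r ∈ LinearMap.range (normalForm p β b)}
      mul_mem' := fun {c d} hc hd r hr => by rw [mul_assoc]; exact hc _ (hd r hr)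
      add_mem' := fun {c d} hc hd r hr => by
        rw [add_mul]; exact Submodule.add_mem _ (hc r hr) (hd r hr)
      algebraMap_mem' := fun c r hr => by
        rw [← Algebra.smul_def]; exact Submodule.smul_mem _ _ hr }
  have hx : x p β b ∈ S := by
    rintro _ ⟨v, rfl⟩
    simp only [normalForm, LinearMap.coe_mk, AddHom.coe_mk, Finset.mul_sum]
    refine Submodule.sum_mem _ fun i _ => ?_
    have h : evalX p β b (t p β) = x p β b := eval_t _ _ _
    rw [← mul_assoc, ← h, ← map_mul]
    exact evalX_mul_y_pow_mem_range β hp b _ _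
  have hy : y p β b ∈ S := by
    rintro _ ⟨v, rfl⟩
    simp only [normalForm, LinearMap.coe_mk, AddHom.coe_mk, Finset.mul_sum]
    refine Submodule.sum_mem _ fun i _ => ?_
    rw [← mul_assoc, y_mul_evalX β hp, mul_assoc, ← pow_succ']
    exact evalX_mul_y_pow_mem_range β hp b _ _
  intro c
  have h1 : (1 : SymbolAlg F p β b) ∈ LinearMap.range (normalForm p β b) := by
    simpa using evalX_mul_y_pow_mem_range β hp b 1 0
  simpa using mem_of_x_mem_of_y_mem hx hy c 1 h1

theorem action_evalX (hp : p.Prime) [CharP F p] (v : ArtinSchreier p β) :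
    action β hp (evalX p β 1 v) = LinearMap.mulLeft F v := by
  have h : (action β hp).comp (evalX p β 1) = Algebra.lmul F (ArtinSchreier p β) := by
    apply AdjoinRoot.algHom_ext'
    ext
    simp [evalX, action]
    rfl
  exact AlgHom.congr_fun h v

theorem action_normalForm (hp : p.Prime) [CharP F p] (v : Fin p → ArtinSchreier p β) :
    action β hp (normalForm p β 1 v) = twist β hp v := by
  simp only [normalForm, twist, LinearMap.coe_mk, AddHom.coe_mk, map_sum, map_mul, map_pow,
    action_evalX]
  simp [action]

theorem action_bijective (hp : p.Prime) [CharP F p] : Function.Bijective (action β hp) := by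
  have h : action β hp ∘ normalForm p β 1 = twist β hp := funext (action_normalForm β hp)
  constructor
  · refine Function.Injective.of_comp_right ?_ (normalForm_surjective β hp 1)
    rw [h]
    exact twist_injective β hp
  · refine Function.Surjective.of_comp (g := normalForm p β 1) ?_
    rw [h]
    exact twist_surjective β hp

/-- `[β, 1) ≅ M_p(F)`. -/
noncomputable def splitEquiv (hp : p.Prime) [CharP F p] :
    SymbolAlg F p β 1 ≃ₐ[F] Matrix (Fin p) (Fin p) F :=
  (AlgEquiv.ofBijective (action β hp) (action_bijective β hp)).trans
    (algEquivMatrix (powerBasis β hp))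

end Split

end SymbolAlg

/-- `[α,γ) ⊗ [β,γ) ≅ M_p(F) ⊗ [α+β,γ)`. -/
theorem symbol_tensor_same_right (p : ℕ) (hp : p.Prime) (F : Type) [Field F] [CharP F p]
    (α β γ : F) (hγ : γ ≠ 0) :
    Nonempty ((SymbolAlg F p α γ ⊗[F] SymbolAlg F p β γ) ≃ₐ[F]
      (Matrix (Fin p) (Fin p) F ⊗[F] SymbolAlg F p (α + β) γ)) :=
  ⟨((SymbolAlg.tensorEquiv α β hp hγ).trans (Algebra.TensorProduct.comm F _ _)).trans
    (Algebra.TensorProduct.congr (SymbolAlg.splitEquiv β hp) AlgEquiv.refl)⟩
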